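/- Let M be a model category, let A and B be cofibrant objects, X a fibrant object, i : A → B a cofibration, and let f : A → X and g : B → X be morphisms such that g ∘ i is homotopic to f. Then there exists a morphism g' : B → X which is homotopic to g and satisfies g' ∘ i = f (the square commutes strictly). -/

import Mathlib

open CategoryTheory CategoryTheory.Limits

universe w v u v₂ u₂ v₃ u₃

/-- A morphism `f` is a retract of a morphism `g` (in the arrow category). -/
def IsRetractOfArrow {C : Type*} [Category C] {X Y X' Y' : C}
    (f : X ⟶ Y) (g : X' ⟶ Y') : Prop :=
  ∃ (a : X ⟶ X') (a' : X' ⟶ X) (b : Y ⟶ Y') (b' : Y' ⟶ Y),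
    a ≫ a' = 𝟙 X ∧ b ≫ b' = 𝟙 Y ∧ a ≫ g = f ≫ b ∧ a' ≫ f = g ≫ b'

/-- A (Quillen) model structure on a category `M`: three distinguished classes of
morphisms (weak equivalences, fibrations and cofibrations) subject to the axioms
MC2–MC5 (two-out-of-three, retract stability, lifting and factorization).
Bicompleteness (MC1) is imposed separately via `HasLimits`/`HasColimits`. -/
structure ModelStructure (M : Type u) [Category.{v} M] where
  weq : MorphismProperty M
  fib : MorphismProperty M
  cof : MorphismProperty M
  weq_of_isIso : ∀ {X Y : M} (f : X ⟶ Y), IsIso f → weq f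
  weq_comp : ∀ {X Y Z : M} (f : X ⟶ Y) (g : Y ⟶ Z), weq f → weq g → weq (f ≫ g)
  weq_of_comp_left : ∀ {X Y Z : M} (f : X ⟶ Y) (g : Y ⟶ Z), weq f → weq (f ≫ g) → weq g
  weq_of_comp_right : ∀ {X Y Z : M} (f : X ⟶ Y) (g : Y ⟶ Z), weq g → weq (f ≫ g) → weq f
  weq_retract : ∀ {X Y X' Y' : M} {f : X ⟶ Y} {g : X' ⟶ Y'},
    IsRetractOfArrow f g → weq g → weq f
  fib_retract : ∀ {X Y X' Y' : M} {f : X ⟶ Y} {g : X' ⟶ Y'},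
    IsRetractOfArrow f g → fib g → fib f
  cof_retract : ∀ {X Y X' Y' : M} {f : X ⟶ Y} {g : X' ⟶ Y'},
    IsRetractOfArrow f g → cof g → cof f
  lifting_cof_acyclicFib : ∀ {A B X Y : M} (i : A ⟶ B) (p : X ⟶ Y),
    cof i → fib p → weq p → HasLiftingProperty i p
  lifting_acyclicCof_fib : ∀ {A B X Y : M} (i : A ⟶ B) (p : X ⟶ Y),
    cof i → weq i → fib p → HasLiftingProperty i p
  factorization_cof_acyclicFib : ∀ {X Y : M} (f : X ⟶ Y),
    ∃ (Z : M) (i : X ⟶ Z) (p : Z ⟶ Y), cof i ∧ fib p ∧ weq p ∧ i ≫ p = f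
  factorization_acyclicCof_fib : ∀ {X Y : M} (f : X ⟶ Y),
    ∃ (Z : M) (i : X ⟶ Z) (p : Z ⟶ Y), cof i ∧ weq i ∧ fib p ∧ i ≫ p = f

variable {M : Type u} [Category.{v} M]

/-- An object is cofibrant if the map from the initial object to it is a cofibration. -/
def ModelStructure.Cofibrant [HasInitial M] (ms : ModelStructure M) (A : M) : Prop :=
  ms.cof (initial.to A)

/-- An object is fibrant if the map to the terminal object is a fibration. -/
def ModelStructure.Fibrant [HasTerminal M] (ms : ModelStructure M) (X : M) : Prop :=
  ms.fib (terminal.from X)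

/-- Maps `f, g : X ⟶ Y` are left homotopic if `f ⊔ g : X ⊔ X ⟶ Y` factors through a
cylinder object of `X`, i.e. through a factorization of the fold map `X ⊔ X ⟶ X` into a
cofibration followed by a weak equivalence. -/
def LeftHomotopic [HasBinaryCoproducts M] (ms : ModelStructure M) {X Y : M}
    (f g : X ⟶ Y) : Prop :=
  ∃ (Cyl : M) (i : X ⨿ X ⟶ Cyl) (p : Cyl ⟶ X) (H : Cyl ⟶ Y),
    ms.cof i ∧ ms.weq p ∧ i ≫ p = coprod.desc (𝟙 X) (𝟙 X) ∧ i ≫ H = coprod.desc f g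

/-- Maps `f, g : X ⟶ Y` are right homotopic if `(f, g) : X ⟶ Y × Y` factors through a
mapping (path) object of `Y`, i.e. through a factorization of the diagonal `Y ⟶ Y × Y`
into a weak equivalence followed by a fibration. -/
def RightHomotopic [HasBinaryProducts M] (ms : ModelStructure M) {X Y : M}
    (f g : X ⟶ Y) : Prop :=
  ∃ (P : M) (s : Y ⟶ P) (q : P ⟶ Y ⨯ Y) (G : X ⟶ P),
    ms.weq s ∧ ms.fib q ∧ s ≫ q = prod.lift (𝟙 Y) (𝟙 Y) ∧ G ≫ q = prod.lift f g

/-- Homotopy of maps from a cofibrant object to a fibrant object (where the notions of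
left and right homotopy coincide), here taken to be left homotopy. -/
def Homotopic [HasBinaryCoproducts M] (ms : ModelStructure M) {X Y : M}
    (f g : X ⟶ Y) : Prop :=
  LeftHomotopic ms f g

theorem isRetractOfArrow_of_retractArrow {X Y X' Y' : M} {f : X ⟶ Y} {g : X' ⟶ Y'}
    (h : RetractArrow f g) : IsRetractOfArrow f g :=
  ⟨h.i.left, h.r.left, h.i.right, h.r.right, h.retract_left, h.retract_right, h.i_w, h.r_w⟩

/-- The Mathlib model category attached to a model structure. -/
@[reducible]
def ModelStructure.toModelCategory [HasLimits M] [HasColimits M] (ms : ModelStructure M) :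
    HomotopicalAlgebra.ModelCategory M :=
  { categoryWithFibrations := ⟨ms.fib⟩
    categoryWithCofibrations := ⟨ms.cof⟩
    categoryWithWeakEquivalences := ⟨ms.weq⟩
    cm1a := inferInstance
    cm1b := inferInstance
    cm2 :=
      { comp_mem := fun f g hf hg => ms.weq_comp f g hf hg
        of_postcomp := fun f g hg hfg => ms.weq_of_comp_right f g hg hfg
        of_precomp := fun f g hf hfg => ms.weq_of_comp_left f g hf hfg }
    cm3a := ⟨fun h hg => ms.weq_retract (isRetractOfArrow_of_retractArrow h) hg⟩
    cm3b := ⟨fun h hg => ms.fib_retract (isRetractOfArrow_of_retractArrow h) hg⟩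
    cm3c := ⟨fun h hg => ms.cof_retract (isRetractOfArrow_of_retractArrow h) hg⟩
    cm4a := fun i p h1 h2 h3 => ms.lifting_acyclicCof_fib i p h1.mem h2.mem h3.mem
    cm4b := fun i p h1 h2 h3 => ms.lifting_cof_acyclicFib i p h1.mem h2.mem h3.mem
    cm5a := ⟨fun f => by
      obtain ⟨Z, i, p, h1, h2, h3, h4⟩ := ms.factorization_acyclicCof_fib f
      exact ⟨⟨Z, i, p, h4, ⟨h1, h2⟩, h3⟩⟩⟩
    cm5b := ⟨fun f => by
      obtain ⟨Z, i, p, h1, h2, h3, h4⟩ := ms.factorization_cof_acyclicFib f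
      exact ⟨⟨Z, i, p, h4, h1, ⟨h2, h3⟩⟩⟩⟩ }

open HomotopicalAlgebra in
theorem strict_extension_aux [ModelCategory M] {A B X : M} (i : A ⟶ B) (f : A ⟶ X) (g : B ⟶ X)
    [IsCofibrant A] [IsCofibrant B] [IsFibrant X] [Cofibration i]
    (h : LeftHomotopyRel (i ≫ g) f) :
    ∃ g' : B ⟶ X, LeftHomotopyRel g' g ∧ i ≫ g' = f := by
  obtain ⟨P, _, ⟨H⟩⟩ := h.rightHomotopyRel.exists_good_pathObject
  have sq : CommSq H.h i P.p₀ g := ⟨H.h₀⟩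
  refine ⟨sq.lift ≫ P.p₁, ?_, ?_⟩
  · have r : RightHomotopyRel g (sq.lift ≫ P.p₁) :=
      ⟨P, ⟨{ h := sq.lift, h₀ := sq.fac_right, h₁ := rfl }⟩⟩
    exact r.leftHomotopyRel.symm
  · rw [← Category.assoc, sq.fac_left]
    exact H.h₁

/-- Let `A`, `B` be cofibrant, `X` fibrant, `i : A ⟶ B` a cofibration,
and `f : A ⟶ X`, `g : B ⟶ X` with `g ∘ i` homotopic to `f`. Then there exists
`g' : B ⟶ X` homotopic to `g` with `i ≫ g' = f` (the triangle commutes strictly). -/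
theorem exists_strict_extension_of_homotopy
    {M : Type u} [Category.{v} M] [HasLimits M] [HasColimits M]
    (ms : ModelStructure M) {A B X : M} (i : A ⟶ B) (f : A ⟶ X) (g : B ⟶ X)
    (hA : ms.Cofibrant A) (hB : ms.Cofibrant B) (hX : ms.Fibrant X)
    (hi : ms.cof i) (h : Homotopic ms (i ≫ g) f) :
    ∃ g' : B ⟶ X, Homotopic ms g' g ∧ i ≫ g' = f := by
  let _ := ms.toModelCategory
  have : HomotopicalAlgebra.IsCofibrant A := ⟨hA⟩
  have : HomotopicalAlgebra.IsCofibrant B := ⟨hB⟩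
  have : HomotopicalAlgebra.IsFibrant X := ⟨hX⟩
  have : HomotopicalAlgebra.Cofibration i := ⟨hi⟩
  obtain ⟨Cyl, j, p, H, hj, hp, hjp, hjH⟩ := h
  have key : HomotopicalAlgebra.LeftHomotopyRel (i ≫ g) f :=
    ⟨{ I := Cyl
       i₀ := coprod.inl ≫ j
       i₁ := coprod.inr ≫ j
       π := p
       i₀_π := by rw [Category.assoc, hjp, coprod.inl_desc]
       i₁_π := by rw [Category.assoc, hjp, coprod.inr_desc]
       weakEquivalence_π := ⟨hp⟩ },
      ⟨{ h := H
         h₀ := by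
          change (coprod.inl ≫ j) ≫ H = _
          rw [Category.assoc, hjH, coprod.inl_desc]
         h₁ := by
          change (coprod.inr ≫ j) ≫ H = _
          rw [Category.assoc, hjH, coprod.inr_desc] }⟩⟩
  obtain ⟨g', hg', e⟩ := strict_extension_aux i f g key
  refine ⟨g', ?_, e⟩
  obtain ⟨P, hP, ⟨K⟩⟩ := hg'.exists_good_cylinder
  refine ⟨P.I, P.i, P.π, K.h, hP.cofibration_i.mem, P.weakEquivalence_π.mem, ?_, ?_⟩
  · apply coprod.hom_ext
    · rw [P.inl_i_assoc, P.i₀_π, coprod.inl_desc]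
    · rw [P.inr_i_assoc, P.i₁_π, coprod.inr_desc]
  · apply coprod.hom_ext
    · rw [P.inl_i_assoc, K.h₀, coprod.inl_desc]
    · rw [P.inr_i_assoc, K.h₁, coprod.inr_desc]
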